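/- arXiv:2112.00923 — 6 statements merged into one kernel-verified Lean document; each statement's English description precedes it below -/
import Mathlib

section
/- Fix β ∈ ℝ and s > 0. Let u = (0,0,u₂,u₃) ∈ ℝ⁴ with u₂ ≠ 0 (the class of a 1-dimensional sheaf), and let v = (v₀,v₁,v₂,v₃) ∈ ℝ⁴ with v₀ ≠ 0. Then as α → +∞, λ_{α,β,s}(u) − λ_{α,β,s}(v) converges to u₃/u₂ − β − ((6s+1)/3)·(v₁/v₀ − β). -/
open Filter Topology

/-- The Bridgeland slope `λ_{α,β,s}(v)` for a numerical Chern character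
`v = (v₀,v₁,v₂,v₃)`, defined via the β-twisted Chern character. -/
noncomputable def bslope (α β s : ℝ) (v : Fin 4 → ℝ) : ℝ :=
  ((v 3 - β * v 2 + β ^ 2 / 2 * v 1 - β ^ 3 / 6 * v 0)
      - (s + 1 / 6) * α ^ 2 * (v 1 - β * v 0)) /
    ((v 2 - β * v 1 + β ^ 2 / 2 * v 0) - α ^ 2 / 2 * v 0)

/-- A quotient of two affine functions of `α ^ 2` tends to the quotient of their leading
coefficients as `α → ∞`. -/
theorem tendsto_affine_sq_div_affine_sq (a b c d : ℝ) (hd : d ≠ 0) :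
    Tendsto (fun α : ℝ => (a + b * α ^ 2) / (c + d * α ^ 2)) atTop (𝓝 (b / d)) := by
  have ht : Tendsto (fun α : ℝ => (α ^ 2)⁻¹) atTop (𝓝 0) :=
    tendsto_inv_atTop_zero.comp (tendsto_pow_atTop two_ne_zero)
  have h : Tendsto (fun α : ℝ => (a * (α ^ 2)⁻¹ + b) / (c * (α ^ 2)⁻¹ + d)) atTop
      (𝓝 ((a * 0 + b) / (c * 0 + d))) :=
    ((ht.const_mul a).add_const b).div ((ht.const_mul c).add_const d) (by simpa using hd)
  simp only [mul_zero, zero_add] at h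
  refine h.congr' ?_
  filter_upwards [eventually_gt_atTop 0] with α hα
  have hα2 : α ^ 2 ≠ 0 := by positivity
  rw [← mul_div_mul_right _ _ hα2, add_mul, add_mul, inv_mul_cancel_right₀ hα2,
    inv_mul_cancel_right₀ hα2]

/-- For a class of nonzero rank, the Bridgeland slope tends to a multiple of
the twisted Mumford slope as `α → ∞`. -/
theorem tendsto_bslope (β s : ℝ) (v : Fin 4 → ℝ) (hv : v 0 ≠ 0) :
    Tendsto (fun α : ℝ => bslope α β s v) atTop
      (𝓝 ((6 * s + 1) / 3 * (v 1 / v 0 - β))) := by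
  have h := tendsto_affine_sq_div_affine_sq
    (v 3 - β * v 2 + β ^ 2 / 2 * v 1 - β ^ 3 / 6 * v 0) (-((s + 1 / 6) * (v 1 - β * v 0)))
    (v 2 - β * v 1 + β ^ 2 / 2 * v 0) (-(v 0 / 2)) (by simpa using hv)
  convert h using 2
  · unfold bslope
    congr 1 <;> ring
  · field_simp
    ring

/-- The Bridgeland slope of a class with `v₀ = v₁ = 0` is independent of `α` and `s`. -/
theorem bslope_of_eq_zero (α β s : ℝ) (u : Fin 4 → ℝ)
    (hu0 : u 0 = 0) (hu1 : u 1 = 0) (hu2 : u 2 ≠ 0) :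
    bslope α β s u = u 3 / u 2 - β := by
  simp only [bslope, hu0, hu1]
  field_simp
  ring

/-- for `u = (0,0,u₂,u₃)` with `u₂ ≠ 0` and `v` with `v₀ ≠ 0`,
as `α → ∞`, `λ(u) − λ(v)` converges to `u₃/u₂ − β − ((6s+1)/3)(v₁/v₀ − β)`. -/
theorem bslope_sub_tendsto (β s : ℝ) (hs : 0 < s) (u v : Fin 4 → ℝ)
    (hu0 : u 0 = 0) (hu1 : u 1 = 0) (hu2 : u 2 ≠ 0) (hv : v 0 ≠ 0) :
    Tendsto (fun α : ℝ => bslope α β s u - bslope α β s v) atTop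
      (𝓝 (u 3 / u 2 - β - (6 * s + 1) / 3 * (v 1 / v 0 - β))) := by
  simp only [bslope_of_eq_zero _ β s u hu0 hu1 hu2]
  exact (tendsto_bslope β s v hv).const_sub _
end

section
/- Fix β ∈ ℝ and s > 0. Let f = (0,f₁,f₂,f₃) ∈ ℝ⁴ with f₁ ≠ 0 and f₂ − βf₁ ≠ 0, and let a ∈ ℝ⁴ with a₀ ≠ 0. Then as α → +∞, (1/α²)·(λ_{α,β,s}(a) − λ_{α,β,s}(f)) converges to ((6s+1)/6)·f₁/(f₂ − βf₁). -/
open Filter Topology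

theorem tendsto_inv_sq_atTop : Tendsto (fun α : ℝ => (α ^ 2)⁻¹) atTop (𝓝 0) :=
  (tendsto_pow_atTop two_ne_zero).inv_tendsto_atTop

/-- If `v₀ ≠ 0`, the slope stays bounded as `α → ∞`, so dividing it by `α²` gives `0`. -/
theorem inv_alpha_sq_mul_bslope_tendsto_zero (β s : ℝ) (v : Fin 4 → ℝ) (hv : v 0 ≠ 0) :
    Tendsto (fun α : ℝ => (α ^ 2)⁻¹ * bslope α β s v) atTop (𝓝 0) := by
  have hu := tendsto_inv_sq_atTop
  have hnum := (hu.mul_const (v 3 - β * v 2 + β ^ 2 / 2 * v 1 - β ^ 3 / 6 * v 0)).sub_const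
    ((s + 1 / 6) * (v 1 - β * v 0))
  have hden := (hu.mul_const (v 2 - β * v 1 + β ^ 2 / 2 * v 0)).sub_const (v 0 / 2)
  have hlim := hu.mul (hnum.div hden (by simpa using hv))
  rw [zero_mul] at hlim
  refine hlim.congr' ?_
  filter_upwards [eventually_ne_atTop 0] with α hα
  simp only [bslope, Pi.div_apply]
  refine congrArg _ (Eq.trans ?_ (mul_div_mul_left _ _ (inv_ne_zero (pow_ne_zero 2 hα))))
  congr 1 <;> field_simp

/-- If `v₀ = 0`, the slope grows like a multiple of `α²`. -/
theorem inv_alpha_sq_mul_bslope_tendsto_of_zero (β s : ℝ) (v : Fin 4 → ℝ) (hv : v 0 = 0) :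
    Tendsto (fun α : ℝ => (α ^ 2)⁻¹ * bslope α β s v) atTop
      (𝓝 (-((s + 1 / 6) * (v 1 / (v 2 - β * v 1))))) := by
  have hlim := ((tendsto_inv_sq_atTop.mul_const (v 3 - β * v 2 + β ^ 2 / 2 * v 1)).sub_const
    ((s + 1 / 6) * v 1)).div_const (v 2 - β * v 1)
  rw [zero_mul, zero_sub, neg_div, mul_div_assoc] at hlim
  refine hlim.congr' ?_
  filter_upwards [eventually_ne_atTop 0] with α hα
  simp only [bslope, hv, mul_zero, sub_zero, add_zero]
  rw [← mul_div_assoc]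
  congr 1
  field_simp

/-- for `f = (0,f₁,f₂,f₃)` with `f₁ ≠ 0`, `f₂ − βf₁ ≠ 0` and `a`
with `a₀ ≠ 0`, `(1/α²)(λ(a) − λ(f)) → ((6s+1)/6)·f₁/(f₂ − βf₁)` as `α → ∞`. -/
theorem inv_alpha_sq_mul_bslope_sub_tendsto (β s : ℝ) (hs : 0 < s)
    (f a : Fin 4 → ℝ) (hf0 : f 0 = 0) (hf1 : f 1 ≠ 0)
    (hf2 : f 2 - β * f 1 ≠ 0) (ha : a 0 ≠ 0) :
    Tendsto (fun α : ℝ => 1 / α ^ 2 * (bslope α β s a - bslope α β s f)) atTop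
      (𝓝 ((6 * s + 1) / 6 * (f 1 / (f 2 - β * f 1)))) := by
  have h := (inv_alpha_sq_mul_bslope_tendsto_zero β s a ha).sub
    (inv_alpha_sq_mul_bslope_tendsto_of_zero β s f hf0)
  simp only [one_div, mul_sub]
  convert h using 2
  ring
end

section
/- Let R ≥ 0 and D > 0 be real numbers, and let r, c, d, e ∈ ℝ with c > 0 and e > 0. Assume that for every α > 0 with α² < 6e/c the following three inequalities hold: (i) 0 < d − (α²/2)·r < D + (α²/2)·R; (ii) α²·(c² − 2rd) + 4d² − 6ce ≥ 0; (iii) α²·(c² + 2(R+r)(D−d)) + 4(D−d)² − 6ce ≥ 0. Then 0 < d < D and 0 < 6ce ≤ min{4d², 4(D−d)²}. -/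
/-- An affine function that is nonnegative on `(0, T)` is nonnegative at `0`. -/
theorem nonneg_of_forall_affine_nonneg {a b T : ℝ} (hT : 0 < T)
    (h : ∀ t, 0 < t → t < T → 0 ≤ t * a + b) : 0 ≤ b := by
  have hlim : Filter.Tendsto (fun t : ℝ => t * a + b) (nhdsWithin 0 (Set.Ioi 0)) (nhds b) := by
    have hcont : Continuous fun t : ℝ => t * a + b := by fun_prop
    simpa using (hcont.tendsto 0).mono_left nhdsWithin_le_nhds
  refine ge_of_tendsto hlim ?_
  filter_upwards [Ioo_mem_nhdsGT hT] with t ht using h t ht.1 ht.2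


/-- numerical constraints along a Bridgeland wall
`(s+1/6)α² = e/c` (i.e. `0 < α² < 6e/c`) for the twisted Chern character
`(−R,0,D,0)` destabilized by `(r,c,d,e)`: heart membership (i) and the
support-property inequalities (ii), (iii) with `K = 1` imply `0 < d < D`
and `0 < 6ce ≤ min{4d², 4(D−d)²}`. -/
theorem wall_bounds (R D r c d e : ℝ) (hR : 0 ≤ R) (hD : 0 < D)
    (hc : 0 < c) (he : 0 < e)
    (h : ∀ α : ℝ, 0 < α → α ^ 2 < 6 * e / c →
      (0 < d - α ^ 2 / 2 * r ∧ d - α ^ 2 / 2 * r < D + α ^ 2 / 2 * R) ∧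
      α ^ 2 * (c ^ 2 - 2 * r * d) + 4 * d ^ 2 - 6 * c * e ≥ 0 ∧
      α ^ 2 * (c ^ 2 + 2 * (R + r) * (D - d)) + 4 * (D - d) ^ 2 - 6 * c * e ≥ 0) :
    (0 < d ∧ d < D) ∧ 0 < 6 * c * e ∧
      6 * c * e ≤ min (4 * d ^ 2) (4 * (D - d) ^ 2) := by
  have hT : 0 < 6 * e / c := by positivity
  have hce : 0 < 6 * c * e := by positivity
  have hsq (t : ℝ) (ht : 0 < t) (htT : t < 6 * e / c) :
      (0 < d - t / 2 * r ∧ d - t / 2 * r < D + t / 2 * R) ∧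
      t * (c ^ 2 - 2 * r * d) + 4 * d ^ 2 - 6 * c * e ≥ 0 ∧
      t * (c ^ 2 + 2 * (R + r) * (D - d)) + 4 * (D - d) ^ 2 - 6 * c * e ≥ 0 := by
    have hα := h (√t) (Real.sqrt_pos.2 ht)
    rw [Real.sq_sqrt ht.le] at hα
    exact hα htT
  have hd : 0 ≤ d := nonneg_of_forall_affine_nonneg (a := -r / 2) hT fun t ht htT => by
    linarith [(hsq t ht htT).1.1]
  have hdD : 0 ≤ D - d := nonneg_of_forall_affine_nonneg (a := (R + r) / 2) hT
    fun t ht htT => by linarith [(hsq t ht htT).1.2]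
  have hA : 0 ≤ 4 * d ^ 2 - 6 * c * e :=
    nonneg_of_forall_affine_nonneg (a := c ^ 2 - 2 * r * d) hT fun t ht htT => by
      linarith [(hsq t ht htT).2.1]
  have hB : 0 ≤ 4 * (D - d) ^ 2 - 6 * c * e :=
    nonneg_of_forall_affine_nonneg (a := c ^ 2 + 2 * (R + r) * (D - d)) hT fun t ht htT => by
      linarith [(hsq t ht htT).2.2]
  have hd0 : 0 < d := by nlinarith
  have hdD0 : 0 < D - d := by nlinarith
  exact ⟨⟨hd0, sub_pos.1 hdD0⟩, hce, le_min (sub_nonneg.1 hA) (sub_nonneg.1 hB)⟩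
end

section
/- Fix integers R ≥ 0 and D ≥ 1. The set of tuples (r,c,d,e) ∈ ℝ⁴ satisfying: r ∈ ℤ, c ∈ ℤ, 2d ∈ ℤ, 6e ∈ ℤ, c > 0, e > 0, 0 < d < D, 6ce ≤ 4d², 6ce ≤ 4(D−d)², and c(d−D)/(3e) − R ≤ r ≤ c·d/(3e), is finite. (Consequently there are only finitely many Bridgeland walls in the (α,s)-plane for the twisted Chern character (−R,0,D,0).) -/
/-- for fixed integers `R ≥ 0`, `D ≥ 1`, the set of wall data
`(r,c,d,e)` with `r,c ∈ ℤ`, `2d ∈ ℤ`, `6e ∈ ℤ`, `c > 0`, `e > 0`, `0 < d < D`,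
`6ce ≤ 4d²`, `6ce ≤ 4(D−d)²` and `c(d−D)/(3e) − R ≤ r ≤ cd/(3e)` is finite;
hence there are finitely many Bridgeland walls in the `(α,s)`-plane for the
twisted Chern character `(−R,0,D,0)`. -/
theorem finitely_many_walls (R D : ℤ) (hR : 0 ≤ R) (hD : 1 ≤ D) :
    {p : ℝ × ℝ × ℝ × ℝ |
      (∃ m : ℤ, p.1 = (m : ℝ)) ∧ (∃ m : ℤ, p.2.1 = (m : ℝ)) ∧
      (∃ m : ℤ, 2 * p.2.2.1 = (m : ℝ)) ∧ (∃ m : ℤ, 6 * p.2.2.2 = (m : ℝ)) ∧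
      0 < p.2.1 ∧ 0 < p.2.2.2 ∧
      0 < p.2.2.1 ∧ p.2.2.1 < (D : ℝ) ∧
      6 * p.2.1 * p.2.2.2 ≤ 4 * p.2.2.1 ^ 2 ∧
      6 * p.2.1 * p.2.2.2 ≤ 4 * ((D : ℝ) - p.2.2.1) ^ 2 ∧
      p.2.1 * (p.2.2.1 - (D : ℝ)) / (3 * p.2.2.2) - (R : ℝ) ≤ p.1 ∧
      p.1 ≤ p.2.1 * p.2.2.1 / (3 * p.2.2.2)}.Finite := by
  refine ((((Set.finite_Icc (-(8 * D ^ 3) - R) (8 * D ^ 3)).prod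
    ((Set.finite_Icc 1 (4 * D ^ 2)).prod
      ((Set.finite_Icc 0 (2 * D)).prod (Set.finite_Icc 1 (4 * D ^ 2))))).image
    (fun q : ℤ × ℤ × ℤ × ℤ =>
      ((q.1 : ℝ), (q.2.1 : ℝ), (q.2.2.1 : ℝ) / 2, (q.2.2.2 : ℝ) / 6)))).subset ?_
  rintro ⟨r, c, d, e⟩ ⟨⟨k, hk⟩, ⟨l, hl⟩, ⟨m, hm⟩, ⟨n, hn⟩, hc, he, hd, hdD, hced, -, hlow, hup⟩
  dsimp only at *
  have hl_one : 1 ≤ l := by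
    have : (0 : ℝ) < l := hl ▸ hc
    exact_mod_cast this
  have hn_one : 1 ≤ n := by
    have : (0 : ℝ) < n := by linarith
    exact_mod_cast this
  have hc_one : 1 ≤ c := by rw [hl]; exact_mod_cast hl_one
  have he_one : 1 ≤ 6 * e := by rw [hn]; exact_mod_cast hn_one
  have hce : c * (6 * e) ≤ 4 * (D : ℝ) ^ 2 := by nlinarith
  have hc_le : c ≤ 4 * (D : ℝ) ^ 2 := by nlinarith
  have he_le : 6 * e ≤ 4 * (D : ℝ) ^ 2 := by nlinarith
  have hD_pos : (0 : ℝ) < D := hd.trans hdD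
  have hcD : c * D ≤ 4 * (D : ℝ) ^ 3 := by nlinarith
  have hquot : c * D / (3 * e) ≤ 8 * (D : ℝ) ^ 3 := by
    rw [div_le_iff₀ (by positivity)]
    nlinarith [pow_pos hD_pos 3]
  have hr_le : r ≤ 8 * (D : ℝ) ^ 3 := by
    refine hup.trans (le_trans ?_ hquot)
    gcongr
  have hr_ge : -(8 * (D : ℝ) ^ 3) - R ≤ r := by
    have : -(c * D / (3 * e)) ≤ c * (d - D) / (3 * e) := by
      rw [← neg_div]
      gcongr
      nlinarith
    linarith
  refine ⟨(k, l, m, n), ⟨⟨?_, ?_⟩, ⟨hl_one, ?_⟩, ⟨?_, ?_⟩, ⟨hn_one, ?_⟩⟩, ?_⟩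
  · rw [hk] at hr_ge; exact_mod_cast hr_ge
  · rw [hk] at hr_le; exact_mod_cast hr_le
  · rw [hl] at hc_le; exact_mod_cast hc_le
  · have : (0 : ℝ) ≤ m := by linarith
    exact_mod_cast this
  · have : (m : ℝ) ≤ 2 * D := by linarith
    exact_mod_cast this
  · rw [hn] at he_le; exact_mod_cast he_le
  · simp only [Prod.mk.injEq]
    refine ⟨hk.symm, hl.symm, ?_, ?_⟩ <;> linarith
end

section
/- The set of tuples (r,c,d,e) ∈ ℝ⁴ satisfying all of the following: r ∈ ℤ, c ∈ ℤ, c > 0, e > 0, d − c²/2 ∈ ℤ, 2e − cd + c³/6 ∈ ℤ, e − c/6 ∈ ℤ, 0 < d < 1, 6ce ≤ 4d², 6ce ≤ 4(1−d)², and c(d−1)/(3e) − 2 ≤ r ≤ c·d/(3e), is exactly { (r, 1, 1/2, 1/6) : r ∈ ℤ, −3 ≤ r ≤ 1 }. (This is the wall classification for the Chern character v = (−2,0,1,0) at β = 0 in Example 6.6 of the paper: there is only one wall with c > 0, namely (s+1/6)α² = 1/6.) -/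
/-- classification of wall data for the Chern character
`v = (−2,0,1,0)` at `β = 0` on ℙ³ (Example 6.6 of the paper): the only
solutions of the numerical wall constraints with `c > 0` are
`(r, 1, 1/2, 1/6)` with `r ∈ ℤ`, `−3 ≤ r ≤ 1`. -/
theorem walls_charge_one :
    {p : ℝ × ℝ × ℝ × ℝ |
      (∃ m : ℤ, p.1 = (m : ℝ)) ∧ (∃ m : ℤ, p.2.1 = (m : ℝ)) ∧
      0 < p.2.1 ∧ 0 < p.2.2.2 ∧
      (∃ m : ℤ, p.2.2.1 - p.2.1 ^ 2 / 2 = (m : ℝ)) ∧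
      (∃ m : ℤ, 2 * p.2.2.2 - p.2.1 * p.2.2.1 + p.2.1 ^ 3 / 6 = (m : ℝ)) ∧
      (∃ m : ℤ, p.2.2.2 - p.2.1 / 6 = (m : ℝ)) ∧
      0 < p.2.2.1 ∧ p.2.2.1 < 1 ∧
      6 * p.2.1 * p.2.2.2 ≤ 4 * p.2.2.1 ^ 2 ∧
      6 * p.2.1 * p.2.2.2 ≤ 4 * (1 - p.2.2.1) ^ 2 ∧
      p.2.1 * (p.2.2.1 - 1) / (3 * p.2.2.2) - 2 ≤ p.1 ∧
      p.1 ≤ p.2.1 * p.2.2.1 / (3 * p.2.2.2)} =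
    {p : ℝ × ℝ × ℝ × ℝ |
      ∃ r : ℤ, -3 ≤ r ∧ r ≤ 1 ∧ p = ((r : ℝ), 1, 1/2, 1/6)} := by
  ext ⟨r, c, d, e⟩
  simp only [Set.mem_ofPred_eq, Prod.mk.injEq]
  constructor
  · rintro ⟨⟨R, rfl⟩, ⟨C, rfl⟩, hc, he, ⟨k, hk⟩, -, ⟨n, hn⟩, hd0, hd1, hwall, -, hrl, hru⟩
    have hd_eq : d = 1 / 2 := by
      have h2d : 2 * d = ((2 * k + C ^ 2 : ℤ) : ℝ) := by push_cast; linarith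
      have hpos : 0 < 2 * k + C ^ 2 := by
        have : (0 : ℝ) < ((2 * k + C ^ 2 : ℤ) : ℝ) := by linarith
        exact_mod_cast this
      have hlt : 2 * k + C ^ 2 < 2 := by
        have : ((2 * k + C ^ 2 : ℤ) : ℝ) < 2 := by linarith
        exact_mod_cast this
      have hone : 2 * k + C ^ 2 = 1 := by lia
      rw [hone] at h2d
      push_cast at h2d
      linarith
    subst hd_eq
    have h6e : 6 * e = ((6 * n + C : ℤ) : ℝ) := by push_cast; linarith
    have hC : 0 < C := by exact_mod_cast hc
    have hE : 0 < 6 * n + C := by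
      have : (0 : ℝ) < ((6 * n + C : ℤ) : ℝ) := by linarith
      exact_mod_cast this
    have hCE : C * (6 * n + C) ≤ 1 := by
      have : (C : ℝ) * ((6 * n + C : ℤ) : ℝ) ≤ 1 := by rw [← h6e]; linarith
      exact_mod_cast this
    have hC1 : C = 1 := by nlinarith
    have hE1 : 6 * n + C = 1 := by nlinarith
    have he_eq : e = 1 / 6 := by
      rw [hE1] at h6e
      push_cast at h6e
      linarith
    subst hC1 he_eq
    norm_num at hrl hru
    refine ⟨R, ?_, ?_, rfl, by norm_num, rfl, rfl⟩
    · have : (-3 : ℝ) ≤ R := by linarith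
      exact_mod_cast this
    · exact_mod_cast hru
  · rintro ⟨R, hl, hu, rfl, rfl, rfl, rfl⟩
    have hl' : (-3 : ℝ) ≤ R := by exact_mod_cast hl
    have hu' : (R : ℝ) ≤ 1 := by exact_mod_cast hu
    refine ⟨⟨R, rfl⟩, ⟨1, by norm_num⟩, by norm_num, by norm_num, ⟨0, by norm_num⟩,
      ⟨0, by norm_num⟩, ⟨0, by norm_num⟩, by norm_num, by norm_num, by norm_num, by norm_num,
      ?_, ?_⟩ <;> norm_num <;> linarith
end

section
/- The set of tuples (r,c,d,e) ∈ ℝ⁴ satisfying all of the following: r ∈ ℤ, c ∈ ℤ, c > 0, e > 0, d − c²/2 ∈ ℤ, 2e − cd + c³/6 ∈ ℤ, e − c/6 ∈ ℤ, 0 < d < 2, 6ce ≤ 4d², 6ce ≤ 4(2−d)², and c(d−2)/(3e) − 2 ≤ r ≤ c·d/(3e), is exactly the union { (r, 1, 1/2, 1/6) : r ∈ ℤ, −5 ≤ r ≤ 1 } ∪ { (r, 2, 1, 1/3) : r ∈ ℤ, −4 ≤ r ≤ 2 } ∪ { (r, 1, 3/2, 1/6) : r ∈ ℤ, −3 ≤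 r ≤ 3 }. (This is the wall classification for the Chern character v = (−2,0,2,0) at β = 0 in Example 6.7 of the paper.) -/
/-- With `d = D / 2` and `e = (c + 6 n) / 6`, the integrality and quadratic constraints
leave three possibilities for `(c, n, D)`. -/
theorem integral_wall_cases {c n k : ℤ} (hc : 0 < c) (he : 0 < c + 6 * n)
    (hd : 0 < c ^ 2 + 2 * k) (hd' : c ^ 2 + 2 * k < 4)
    (h₁ : c * (c + 6 * n) ≤ (c ^ 2 + 2 * k) ^ 2)
    (h₂ : c * (c + 6 * n) ≤ (4 - (c ^ 2 + 2 * k)) ^ 2) :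
    (c = 1 ∧ n = 0 ∧ k = 0) ∨ (c = 2 ∧ n = 0 ∧ k = -1) ∨ (c = 1 ∧ n = 0 ∧ k = 1) := by
  obtain ⟨D, hD⟩ : ∃ D, D = c ^ 2 + 2 * k := ⟨_, rfl⟩
  rw [← hD] at hd hd' h₁ h₂
  have hc4 : c ≤ 4 := by
    have : c * (c + 6 * n) ≤ 4 := by interval_cases D <;> linarith
    nlinarith
  interval_cases D <;> interval_cases c <;> omega

/-- classification of wall data for the Chern character
`v = (−2,0,2,0)` at `β = 0` on ℙ³ (Example 6.7 of the paper): the solutions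
of the numerical wall constraints with `c > 0` are exactly
`(r, 1, 1/2, 1/6)` for `−5 ≤ r ≤ 1`, `(r, 2, 1, 1/3)` for `−4 ≤ r ≤ 2`,
and `(r, 1, 3/2, 1/6)` for `−3 ≤ r ≤ 3` (with `r ∈ ℤ`). -/
theorem walls_charge_two :
    {p : ℝ × ℝ × ℝ × ℝ |
      (∃ m : ℤ, p.1 = (m : ℝ)) ∧ (∃ m : ℤ, p.2.1 = (m : ℝ)) ∧
      0 < p.2.1 ∧ 0 < p.2.2.2 ∧
      (∃ m : ℤ, p.2.2.1 - p.2.1 ^ 2 / 2 = (m : ℝ)) ∧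
      (∃ m : ℤ, 2 * p.2.2.2 - p.2.1 * p.2.2.1 + p.2.1 ^ 3 / 6 = (m : ℝ)) ∧
      (∃ m : ℤ, p.2.2.2 - p.2.1 / 6 = (m : ℝ)) ∧
      0 < p.2.2.1 ∧ p.2.2.1 < 2 ∧
      6 * p.2.1 * p.2.2.2 ≤ 4 * p.2.2.1 ^ 2 ∧
      6 * p.2.1 * p.2.2.2 ≤ 4 * (2 - p.2.2.1) ^ 2 ∧
      p.2.1 * (p.2.2.1 - 2) / (3 * p.2.2.2) - 2 ≤ p.1 ∧
      p.1 ≤ p.2.1 * p.2.2.1 / (3 * p.2.2.2)} =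
    {p : ℝ × ℝ × ℝ × ℝ |
      ∃ r : ℤ, -5 ≤ r ∧ r ≤ 1 ∧ p = ((r : ℝ), 1, 1/2, 1/6)} ∪
    {p : ℝ × ℝ × ℝ × ℝ |
      ∃ r : ℤ, -4 ≤ r ∧ r ≤ 2 ∧ p = ((r : ℝ), 2, 1, 1/3)} ∪
    {p : ℝ × ℝ × ℝ × ℝ |
      ∃ r : ℤ, -3 ≤ r ∧ r ≤ 3 ∧ p = ((r : ℝ), 1, 3/2, 1/6)} := by
  ext ⟨r, c, d, e⟩
  simp only [Set.mem_ofPred_eq, Set.mem_union, Prod.mk.injEq]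
  constructor
  · rintro ⟨⟨r, rfl⟩, ⟨c, rfl⟩, hc, he, ⟨k, hk⟩, -, ⟨n, hn⟩, hd, hd', h₁, h₂, hr, hr'⟩
    obtain rfl : d = (c : ℝ) ^ 2 / 2 + k := by linarith
    obtain rfl : e = (c : ℝ) / 6 + n := by linarith
    have key := integral_wall_cases (c := c) (n := n) (k := k) (by exact_mod_cast hc)
      (by have : (0 : ℝ) < c + 6 * n := by linarith
          exact_mod_cast this)
      (by have : (0 : ℝ) < (c : ℝ) ^ 2 + 2 * k := by linarith
          exact_mod_cast this)
      (by have : (c : ℝ) ^ 2 + 2 * k < 4 := by linarith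
          exact_mod_cast this)
      (by have : (c : ℝ) * (c + 6 * n) ≤ ((c : ℝ) ^ 2 + 2 * k) ^ 2 := by linarith
          exact_mod_cast this)
      (by have : (c : ℝ) * (c + 6 * n) ≤ (4 - ((c : ℝ) ^ 2 + 2 * k)) ^ 2 := by linarith
          exact_mod_cast this)
    rcases key with ⟨rfl, rfl, rfl⟩ | ⟨rfl, rfl, rfl⟩ | ⟨rfl, rfl, rfl⟩
    · refine Or.inl (Or.inl ⟨r, ?_, ?_, rfl, ?_, ?_, ?_⟩)
      all_goals norm_num at hr hr' ⊢
      · exact_mod_cast hr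
      · exact_mod_cast hr'
    · refine Or.inl (Or.inr ⟨r, ?_, ?_, rfl, ?_, ?_, ?_⟩)
      all_goals norm_num at hr hr' ⊢
      · exact_mod_cast hr
      · exact_mod_cast hr'
    · refine Or.inr ⟨r, ?_, ?_, rfl, ?_, ?_, ?_⟩
      all_goals norm_num at hr hr' ⊢
      · exact_mod_cast hr
      · exact_mod_cast hr'
  · rintro ((⟨r, hr, hr', rfl, rfl, rfl, rfl⟩ | ⟨r, hr, hr', rfl, rfl, rfl, rfl⟩) |
      ⟨r, hr, hr', rfl, rfl, rfl, rfl⟩)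
    · have h : (-5 : ℝ) ≤ r := by exact_mod_cast hr
      have h' : (r : ℝ) ≤ 1 := by exact_mod_cast hr'
      refine ⟨⟨r, rfl⟩, ⟨1, ?_⟩, ?_, ?_, ⟨0, ?_⟩, ⟨0, ?_⟩, ⟨0, ?_⟩, ?_, ?_, ?_, ?_, ?_, ?_⟩ <;>
        norm_num <;> linarith
    · have h : (-4 : ℝ) ≤ r := by exact_mod_cast hr
      have h' : (r : ℝ) ≤ 2 := by exact_mod_cast hr'
      refine ⟨⟨r, rfl⟩, ⟨2, ?_⟩, ?_, ?_, ⟨-1, ?_⟩, ⟨0, ?_⟩, ⟨0, ?_⟩, ?_, ?_, ?_, ?_, ?_, ?_⟩ <;>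
        norm_num <;> linarith
    · have h : (-3 : ℝ) ≤ r := by exact_mod_cast hr
      have h' : (r : ℝ) ≤ 3 := by exact_mod_cast hr'
      refine ⟨⟨r, rfl⟩, ⟨1, ?_⟩, ?_, ?_, ⟨1, ?_⟩, ⟨-1, ?_⟩, ⟨0, ?_⟩, ?_, ?_, ?_, ?_, ?_, ?_⟩ <;>
        norm_num <;> linarith
end
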